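/- Let p : X̃ → X be a covering map between topological spaces and let Φ be a flow on X. Then there exists a unique flow Φ̃ on X̃ lifting Φ, that is, a unique continuous map Φ̃ : ℝ × X̃ → X̃ satisfying Φ̃(0, x̃) = x̃, Φ̃(σ+τ, x̃) = Φ̃(σ, Φ̃(τ, x̃)), and p(Φ̃(τ, x̃)) = Φ(τ, p(x̃)) for all σ, τ ∈ ℝ and x̃ ∈ X̃. -/

import Mathlib

open unitInterval in
/-- Homotopy lifting along `ℝ`: a map `ℝ × A → X` lifts through a covering map, starting from a
given lift of its restriction to `{0} × A`. -/
theorem IsCoveringMap.exists_lift_real {E X A : Type*} [TopologicalSpace E] [TopologicalSpace X]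
    [TopologicalSpace A] {p : E → X} (cov : IsCoveringMap p) (F : C(ℝ × A, X)) (f : C(A, E))
    (hF : ∀ a, F (0, a) = p (f a)) :
    ∃ G : C(ℝ × A, E), (∀ a, G (0, a) = f a) ∧ ∀ t a, p (G (t, a)) = F (t, a) := by
  let H : C(I × (ℝ × A), X) :=
    ⟨fun q ↦ F ((q.1 : ℝ) * q.2.1, q.2.2), by fun_prop⟩
  have H_zero : ∀ b, H (0, b) = p (f.comp ContinuousMap.snd b) := fun b ↦ by simp [H, hF]
  let L := cov.liftHomotopy H (f.comp ContinuousMap.snd) H_zero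
  have L_lifts (q) : p (L q) = H q := congr_fun (cov.liftHomotopy_lifts H _ H_zero) q
  refine ⟨⟨fun b ↦ L (1, b), by fun_prop⟩, fun a ↦ ?_, fun t a ↦ ?_⟩
  · have h : L (1, (0, a)) = L (0, (0, a)) :=
      cov.const_of_comp (g := fun s : I ↦ L (s, (0, a))) (by fun_prop)
        (fun s s' ↦ by simp [L_lifts, H]) 1 0
    exact h.trans (cov.liftHomotopy_zero H _ H_zero (0, a))
  · simp [L_lifts, H]

/-- Let `p : X̃ → X` be a covering map (a continuous surjection that is
evenly covered over every point) and `Φ` a flow on `X`. Then there is a unique flow `Φ̃`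
on `X̃` lifting `Φ`. -/
theorem stmt4 {Xt X : Type*} [TopologicalSpace Xt] [TopologicalSpace X]
    (p : Xt → X) (hp : IsCoveringMap p) (hpsurj : Function.Surjective p)
    (Φ : ℝ × X → X) (hΦcont : Continuous Φ)
    (hΦ0 : ∀ x : X, Φ (0, x) = x)
    (hΦadd : ∀ σ τ : ℝ, ∀ x : X, Φ (σ + τ, x) = Φ (σ, Φ (τ, x))) :
    ∃! Φt : ℝ × Xt → Xt, Continuous Φt ∧
      (∀ xt : Xt, Φt (0, xt) = xt) ∧
      (∀ σ τ : ℝ, ∀ xt : Xt, Φt (σ + τ, xt) = Φt (σ, Φt (τ, xt))) ∧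
      (∀ τ : ℝ, ∀ xt : Xt, p (Φt (τ, xt)) = Φ (τ, p xt)) := by
  obtain ⟨G, G_zero, G_lifts⟩ := hp.exists_lift_real
    ⟨fun q : ℝ × Xt ↦ Φ (q.1, p q.2), hΦcont.comp (by have := hp.continuous; fun_prop)⟩
    (.id Xt) fun x ↦ hΦ0 (p x)
  simp only [ContinuousMap.id_apply, ContinuousMap.coe_mk] at G_zero G_lifts
  refine ⟨G, ⟨G.continuous, G_zero, fun σ τ x ↦ ?_, G_lifts⟩, ?_⟩
  · refine congr_fun (hp.eq_of_comp_eq (g₁ := fun s : ℝ ↦ G (s + τ, x))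
      (g₂ := fun s : ℝ ↦ G (s, G (τ, x))) (by fun_prop) (by fun_prop) ?_ 0 ?_) σ
    · ext s
      simp [G_lifts, hΦadd]
    · simp [G_zero]
  · rintro Φt ⟨Φt_cont, Φt_zero, -, Φt_lifts⟩
    ext ⟨t, x⟩
    refine congr_fun (hp.eq_of_comp_eq (g₁ := fun s : ℝ ↦ Φt (s, x))
      (g₂ := fun s : ℝ ↦ G (s, x)) (by fun_prop) (by fun_prop) ?_ 0 ?_) t
    · ext s
      simp [G_lifts, Φt_lifts]
    · simp [G_zero, Φt_zero]
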